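/- arXiv:1710.05558 — 2 statements merged into one kernel-verified Lean document; each statement's English description precedes it below -/
import Mathlib

section
/- Let r ∈ ℝ with r ≠ 0 and let γ be the 4 × 4 real matrix with all diagonal entries equal to 1, entries equal to r immediately above the diagonal, and all other entries 0. Let v : ℕ → ℝ⁴ be a sequence converging to a vector v with last coordinate v₄ ≠ 0, and for each n let Lₙ be the real linear span of e₁ = (1,0,0,0) and v(n). Then there exists a sequence w : ℕ → ℝ⁴ such that for every n the image of Lₙ under the linear map x ↦ γ^{n} x equals the real linear span of e₁ and w(n), and n^{-2} • w(n) converges to (r² · v₄ / 2) • e₂, where e₂ = (0, 1, 0, 0). -/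
open Filter

theorem Submodule.span_pair_sub_smul_right {R M : Type*} [Ring R] [AddCommGroup M] [Module R M]
    (x y : M) (c : R) : span R {x, y - c • x} = span R {x, y} := by
  apply le_antisymm <;> rw [span_le, Set.pair_subset_iff]
  · exact ⟨mem_span_of_mem (by simp), sub_mem (mem_span_of_mem (by simp))
      (smul_mem _ c (mem_span_of_mem (by simp)))⟩
  · refine ⟨mem_span_of_mem (by simp), ?_⟩
    have h : (y - c • x) + c • x ∈ span R {x, y - c • x} :=
      add_mem (mem_span_of_mem (by simp)) (smul_mem _ c (mem_span_of_mem (by simp)))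
    rwa [sub_add_cancel] at h

section Jordan

variable {r : ℝ} {γ : Matrix (Fin 4) (Fin 4) ℝ}

theorem unipotent_mulVec
    (hγ : ∀ i j : Fin 4, γ i j = if i = j then 1 else if (j : ℕ) = (i : ℕ) + 1 then r else 0)
    (x : Fin 4 → ℝ) :
    γ.mulVec x = ![x 0 + r * x 1, x 1 + r * x 2, x 2 + r * x 3, x 3] := by
  ext i
  fin_cases i <;> simp [Matrix.mulVec, dotProduct, Fin.sum_univ_four, hγ]

theorem unipotent_pow_mulVec_single
    (hγ : ∀ i j : Fin 4, γ i j = if i = j then 1 else if (j : ℕ) = (i : ℕ) + 1 then r else 0)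
    (n : ℕ) : (γ ^ n).mulVec ![1, 0, 0, 0] = ![1, 0, 0, 0] := by
  induction n with
  | zero => simp
  | succ n ih =>
    rw [pow_succ', ← Matrix.mulVec_mulVec, ih, unipotent_mulVec hγ]
    simp

theorem unipotent_pow_mulVec_tail
    (hγ : ∀ i j : Fin 4, γ i j = if i = j then 1 else if (j : ℕ) = (i : ℕ) + 1 then r else 0)
    (n : ℕ) (x : Fin 4 → ℝ) :
    (γ ^ n).mulVec x 1 = x 1 + n * r * x 2 + n * (n - 1) / 2 * r ^ 2 * x 3 ∧
    (γ ^ n).mulVec x 2 = x 2 + n * r * x 3 ∧ (γ ^ n).mulVec x 3 = x 3 := by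
  induction n with
  | zero => simp
  | succ n ih =>
    obtain ⟨h1, h2, h3⟩ := ih
    rw [pow_succ', ← Matrix.mulVec_mulVec, unipotent_mulVec hγ]
    refine ⟨?_, ?_, ?_⟩ <;> simp [h1, h2, h3] <;> ring

end Jordan

theorem map_span_unipotent_tendsto (r : ℝ) (hr : r ≠ 0)
    (γ : Matrix (Fin 4) (Fin 4) ℝ)
    (hγ : ∀ i j : Fin 4, γ i j =
      if i = j then 1 else if (j : ℕ) = (i : ℕ) + 1 then r else 0)
    (v : ℕ → Fin 4 → ℝ) (vlim : Fin 4 → ℝ)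
    (hv : Tendsto v atTop (nhds vlim)) (hv4 : vlim 3 ≠ 0) :
    ∃ w : ℕ → Fin 4 → ℝ,
      (∀ n : ℕ, Submodule.map (γ ^ n).mulVecLin
          (Submodule.span ℝ ({![1, 0, 0, 0], v n} : Set (Fin 4 → ℝ))) =
        Submodule.span ℝ ({![1, 0, 0, 0], w n} : Set (Fin 4 → ℝ))) ∧
      Tendsto (fun n : ℕ => ((n : ℝ) ^ 2)⁻¹ • w n) atTop
        (nhds ((r ^ 2 * vlim 3 / 2) • ![0, 1, 0, 0])) := by
  refine ⟨fun n => (γ ^ n).mulVec (v n) - (γ ^ n).mulVec (v n) 0 • ![1, 0, 0, 0],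
    fun n => ?_, ?_⟩
  · rw [Submodule.span_pair_sub_smul_right, Submodule.map_span, Set.image_pair,
      Matrix.mulVecLin_apply, Matrix.mulVecLin_apply, unipotent_pow_mulVec_single hγ]
  have hcoord := tendsto_pi_nhds.1 hv
  have hinv : Tendsto (fun n : ℕ => (n : ℝ)⁻¹) atTop (nhds 0) := tendsto_inv_atTop_nhds_zero_nat
  have hinv2 : Tendsto (fun n : ℕ => (n : ℝ)⁻¹ ^ 2) atTop (nhds 0) := by
    simpa using hinv.pow 2
  refine tendsto_pi_nhds.2 fun i => ?_
  fin_cases i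
  · simp [-Matrix.sub_cons]
  · have h := ((hinv2.mul (hcoord 1)).add ((hinv.mul_const r).mul (hcoord 2))).add
      ((((hinv.const_sub 1).div_const 2).mul_const (r ^ 2)).mul (hcoord 3))
    refine (h.congr' ?_).trans_eq (by congr 1; simp; ring)
    filter_upwards [eventually_ne_atTop 0] with n hn
    have hn : (n : ℝ) ≠ 0 := Nat.cast_ne_zero.2 hn
    simp [-Matrix.sub_cons, (unipotent_pow_mulVec_tail hγ n (v n)).1]
    field_simp
  · have h := (hinv2.mul (hcoord 2)).add ((hinv.mul_const r).mul (hcoord 3))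
    refine (h.congr' ?_).trans_eq (by simp)
    filter_upwards [eventually_ne_atTop 0] with n hn
    have hn : (n : ℝ) ≠ 0 := Nat.cast_ne_zero.2 hn
    simp [-Matrix.sub_cons, (unipotent_pow_mulVec_tail hγ n (v n)).2.1]
    field_simp
  · simpa [-Matrix.sub_cons, (unipotent_pow_mulVec_tail hγ _ _).2.2] using hinv2.mul (hcoord 3)
end

section
/- Let r, s ∈ ℝ with 0 < r < 1 and s ≠ 0. Let γ : ℝ² × ℝ² → ℝ² × ℝ² be the linear map γ(x, y) = (B x, C y), where B(x₁, x₂) = (r·x₁ + s·x₂, r·x₂) and C(y₁, y₂) = (y₁ + s·y₂, y₂). Let A : ℝ² → ℝ² be any linear map and let L_A = {(A y, y) : y ∈ ℝ²}, a 2-dimensional subspace of ℝ² × ℝ². Then there exist sequences u, w : ℕ → ℝ² × ℝ² such that for every n the image of L_A under γ^{n} equals the real linear span of u(n) and w(n), and u(n) → (0, (1, 0)) and w(n) → (0, (0, 1)) as n → ∞. -/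
open Filter

theorem span_pair_shear_eq_top {R : Type*} [CommRing R] (c : R) :
    Submodule.span R {((1 : R), (0 : R)), (c, 1)} = ⊤ := by
  refine (Submodule.eq_top_iff').2 fun y => Submodule.mem_span_pair.2 ⟨y.1 - c * y.2, y.2, ?_⟩
  ext
  · simp [mul_comm]
  · simp

theorem pow_apply_of_jordan_blocks {r s : ℝ} (hr : r ≠ 0)
    {γ : Module.End ℝ ((ℝ × ℝ) × (ℝ × ℝ))}
    (hγ : ∀ x₁ x₂ y₁ y₂ : ℝ,
      γ ((x₁, x₂), (y₁, y₂)) = ((r * x₁ + s * x₂, r * x₂), (y₁ + s * y₂, y₂)))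
    (n : ℕ) (x₁ x₂ y₁ y₂ : ℝ) :
    (γ ^ n) ((x₁, x₂), (y₁, y₂)) =
      ((r ^ n * x₁ + n * r ^ n * (s / r * x₂), r ^ n * x₂), (y₁ + n * s * y₂, y₂)) := by
  induction n with
  | zero => simp
  | succ n ih =>
    rw [pow_succ', Module.End.mul_apply, ih, hγ]
    ext
    · simp
      field_simp
      ring
    · simp
      ring
    · simp
      ring
    · simp

theorem map_graph_c3_tendsto (r s : ℝ) (hr0 : 0 < r) (hr1 : r < 1) (hs : s ≠ 0)
    (γ : Module.End ℝ ((ℝ × ℝ) × (ℝ × ℝ)))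
    (hγ : ∀ x₁ x₂ y₁ y₂ : ℝ,
      γ ((x₁, x₂), (y₁, y₂)) = ((r * x₁ + s * x₂, r * x₂), (y₁ + s * y₂, y₂)))
    (A : (ℝ × ℝ) →ₗ[ℝ] (ℝ × ℝ)) :
    ∃ u w : ℕ → (ℝ × ℝ) × (ℝ × ℝ),
      (∀ n : ℕ, Submodule.map (γ ^ n) (LinearMap.range (A.prod LinearMap.id)) =
        Submodule.span ℝ {u n, w n}) ∧
      Tendsto u atTop (nhds (((0 : ℝ), (0 : ℝ)), ((1 : ℝ), (0 : ℝ)))) ∧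
      Tendsto w atTop (nhds (((0 : ℝ), (0 : ℝ)), ((0 : ℝ), (1 : ℝ)))) := by
  have hpow := pow_apply_of_jordan_blocks hr0.ne' hγ
  have h_abs : |r| < 1 := by rwa [abs_of_pos hr0]
  have h0 : Tendsto (fun n : ℕ => r ^ n) atTop (nhds 0) :=
    tendsto_pow_atTop_nhds_zero_of_abs_lt_one h_abs
  have h1 : Tendsto (fun n : ℕ => (n : ℝ) * r ^ n) atTop (nhds 0) :=
    tendsto_self_mul_const_pow_of_abs_lt_one h_abs
  have h2 : Tendsto (fun n : ℕ => (n : ℝ) ^ 2 * r ^ n) atTop (nhds 0) :=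
    tendsto_pow_const_mul_const_pow_of_abs_lt_one 2 h_abs
  obtain ⟨a, b, hab⟩ : ∃ a b, A (1, 0) = (a, b) := ⟨_, _, rfl⟩
  obtain ⟨c, d, hcd⟩ : ∃ c d, A (0, 1) = (c, d) := ⟨_, _, rfl⟩
  have hA (t : ℝ) : A (t, 1) = (t * a + c, t * b + d) := by
    have ht : ((t, 1) : ℝ × ℝ) = t • (1, 0) + (0, 1) := by simp
    rw [ht, map_add, map_smul, hab, hcd]
    simp
  refine ⟨fun n => (γ ^ n) (A.prod LinearMap.id (1, 0)),
    fun n => (γ ^ n) (A.prod LinearMap.id (-(n * s), 1)), fun n => ?_, ?_, ?_⟩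
  · rw [LinearMap.range_eq_map, ← span_pair_shear_eq_top (-(n * s)), Submodule.map_span,
      Submodule.map_span, Set.image_pair, Set.image_pair]
  · simp only [LinearMap.prod_apply, Function.prod_apply, LinearMap.id_apply, hab, hpow]
    refine (Tendsto.prodMk_nhds ?_ ?_).prodMk_nhds (Tendsto.prodMk_nhds ?_ ?_)
    · simpa using (h0.mul_const a).add (h1.mul_const (s / r * b))
    · simpa using h0.mul_const b
    · simp
    · simp
  · simp only [LinearMap.prod_apply, Function.prod_apply, LinearMap.id_apply, hA, hpow]
    refine (Tendsto.prodMk_nhds ?_ ?_).prodMk_nhds (Tendsto.prodMk_nhds ?_ ?_)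
    · have h := ((h0.mul_const c).add (h1.mul_const (s / r * d - s * a))).sub
        (h2.mul_const (s / r * s * b))
      simp only [zero_mul, add_zero, sub_zero] at h
      exact h.congr fun n => by ring
    · have h := (h0.mul_const d).sub (h1.mul_const (s * b))
      simp only [zero_mul, sub_zero] at h
      exact h.congr fun n => by ring
    · simp
    · simp
end
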